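/- Suppose points p₁, p₂, p₃ ∈ ℝ² are in general position (affinely independent) and quadratic functions φ₁, φ₂, φ₃ : ℝ² → ℝ satisfy φᵢ(p_k) = φⱼ(p_k) and Dφᵢ(p_k) = Dφⱼ(p_k) for every permutation {i,j,k} = {1,2,3}. Then there exist a symmetric matrix B₀ and reals α₁, α₂, α₃ with D²φᵢ = B₀ + αᵢ (pⱼ − p_k)^⊥ ⊗ (pⱼ − p_k)^⊥ for each {i,j,k} = {1,2,3}. -/

import Mathlib

open Matrix

/-- Value of the quadratic function with Hessian `A`, linear part `b`, constant `c`. -/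
noncomputable def quadf (A : Matrix (Fin 2) (Fin 2) ℝ) (b : Fin 2 → ℝ) (c : ℝ)
    (x : Fin 2 → ℝ) : ℝ :=
  (1/2 : ℝ) * (x ⬝ᵥ A.mulVec x) + b ⬝ᵥ x + c

/-- Gradient of the quadratic function with Hessian `A` and linear part `b`. -/
def gradf (A : Matrix (Fin 2) (Fin 2) ℝ) (b : Fin 2 → ℝ) (x : Fin 2 → ℝ) :
    Fin 2 → ℝ :=
  A.mulVec x + b

/-- Rotation by 90°: `(x,y)^⊥ = (−y,x)`. -/
def perp (v : Fin 2 → ℝ) : Fin 2 → ℝ := ![-(v 1), v 0]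

/-- Outer product `w ⊗ w`. -/
def outer (w : Fin 2 → ℝ) : Matrix (Fin 2) (Fin 2) ℝ := Matrix.vecMulVec w w

lemma quadf_taylor {A : Matrix (Fin 2) (Fin 2) ℝ} (hA : A.IsSymm) (b : Fin 2 → ℝ) (c : ℝ)
    (p x : Fin 2 → ℝ) :
    quadf A b c x =
      quadf A b c p + gradf A b p ⬝ᵥ (x - p) + (1/2 : ℝ) * ((x - p) ⬝ᵥ A.mulVec (x - p)) := by
  have h : A 1 0 = A 0 1 := hA.apply 0 1
  simp only [quadf, gradf, dotProduct, mulVec, Fin.sum_univ_two, Pi.add_apply, Pi.sub_apply, h]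
  ring

lemma quadf_sub_of_contact {A A' : Matrix (Fin 2) (Fin 2) ℝ} (hA : A.IsSymm) (hA' : A'.IsSymm)
    {b b' : Fin 2 → ℝ} {c c' : ℝ} {p : Fin 2 → ℝ} (hv : quadf A b c p = quadf A' b' c' p)
    (hg : gradf A b p = gradf A' b' p) (x : Fin 2 → ℝ) :
    quadf A b c x - quadf A' b' c' x = (1/2 : ℝ) * ((x - p) ⬝ᵥ (A - A').mulVec (x - p)) := by
  rw [quadf_taylor hA b c p x, quadf_taylor hA' b' c' p x, hv, hg, sub_mulVec,
    dotProduct_sub (x - p)]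
  ring

lemma gradf_sub_of_contact {A A' : Matrix (Fin 2) (Fin 2) ℝ} {b b' p : Fin 2 → ℝ}
    (hg : gradf A b p = gradf A' b' p) (x : Fin 2 → ℝ) :
    gradf A b x - gradf A' b' x = (A - A').mulVec (x - p) := by
  have h : A.mulVec p + b - (A'.mulVec p + b') = 0 := sub_eq_zero.mpr hg
  rw [mulVec_sub, sub_mulVec, sub_mulVec, ← sub_zero (gradf A b x - gradf A' b' x), ← h]
  simp only [gradf]
  abel

lemma outer_perp_sub_comm (u v : Fin 2 → ℝ) : outer (perp (u - v)) = outer (perp (v - u)) := by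
  ext i j
  fin_cases i <;> fin_cases j <;> simp [outer, perp, vecMulVec_apply] <;> ring

/-- A symmetric matrix, expanded in the rank-one matrices dual to `u`, `v`, when its bilinear form
takes equal values at `(u, u)` and `(u, v)`. -/
lemma det_sq_smul_eq_outer_perp {S : Matrix (Fin 2) (Fin 2) ℝ} (hS : S.IsSymm)
    {u v : Fin 2 → ℝ} (h : u ⬝ᵥ S.mulVec u = u ⬝ᵥ S.mulVec v) :
    (u 0 * v 1 - u 1 * v 0) ^ 2 • S =
      (v ⬝ᵥ S.mulVec v - u ⬝ᵥ S.mulVec u) • outer (perp u)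
        + (u ⬝ᵥ S.mulVec u) • outer (perp (u - v)) := by
  have hs : S 1 0 = S 0 1 := hS.apply 0 1
  simp only [dotProduct, mulVec, Fin.sum_univ_two, hs] at h ⊢
  ext i j
  fin_cases i <;> fin_cases j <;> simp [outer, perp, hs]
  · linear_combination (2 * u 1 * v 1) * h
  · linear_combination (-(u 0 * v 1 + u 1 * v 0)) * h
  · linear_combination (-(u 0 * v 1 + u 1 * v 0)) * h
  · linear_combination (2 * u 0 * v 0) * h

lemma cross_ne_zero_of_linearIndependent {u v : Fin 2 → ℝ} (h : LinearIndependent ℝ ![u, v]) :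
    u 0 * v 1 - u 1 * v 0 ≠ 0 := by
  have h' : LinearIndependent ℝ (Matrix.of ![u, v]).row := h
  rw [linearIndependent_rows_iff_isUnit, isUnit_iff_isUnit_det, det_fin_two, isUnit_iff_ne_zero]
    at h'
  simpa using h'

theorem stmt_12 (p₁ p₂ p₃ : Fin 2 → ℝ)
    (hgen : LinearIndependent ℝ ![p₂ - p₁, p₃ - p₁])
    (A₁ A₂ A₃ : Matrix (Fin 2) (Fin 2) ℝ)
    (hA₁ : A₁.IsSymm) (hA₂ : A₂.IsSymm) (hA₃ : A₃.IsSymm)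
    (b₁ b₂ b₃ : Fin 2 → ℝ) (c₁ c₂ c₃ : ℝ)
    (hv₁ : quadf A₂ b₂ c₂ p₁ = quadf A₃ b₃ c₃ p₁)
    (hv₂ : quadf A₃ b₃ c₃ p₂ = quadf A₁ b₁ c₁ p₂)
    (hv₃ : quadf A₁ b₁ c₁ p₃ = quadf A₂ b₂ c₂ p₃)
    (hg₁ : gradf A₂ b₂ p₁ = gradf A₃ b₃ p₁)
    (hg₂ : gradf A₃ b₃ p₂ = gradf A₁ b₁ p₂)
    (hg₃ : gradf A₁ b₁ p₃ = gradf A₂ b₂ p₃) :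
    ∃ (B₀ : Matrix (Fin 2) (Fin 2) ℝ) (α₁ α₂ α₃ : ℝ),
      B₀.IsSymm ∧
      A₁ = B₀ + α₁ • outer (perp (p₂ - p₃)) ∧
      A₂ = B₀ + α₂ • outer (perp (p₃ - p₁)) ∧
      A₃ = B₀ + α₃ • outer (perp (p₁ - p₂)) := by
  obtain ⟨u, hu⟩ : ∃ u, u = p₂ - p₁ := ⟨_, rfl⟩
  obtain ⟨v, hv⟩ : ∃ v, v = p₃ - p₁ := ⟨_, rfl⟩
  have hu' : p₁ - p₂ = -u := by rw [hu, neg_sub]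
  have hv' : p₁ - p₃ = -v := by rw [hv, neg_sub]
  have huv : p₂ - p₃ = u - v := by rw [hu, hv]; abel
  rw [← hu, ← hv] at hgen
  have hd := cross_ne_zero_of_linearIndependent hgen
  have hsM : (A₃ - A₁).IsSymm := hA₃.sub hA₁
  have hsN : (A₁ - A₂).IsSymm := hA₁.sub hA₂
  have hq₂ := quadf_sub_of_contact hA₃ hA₁ hv₂ hg₂ p₁
  have hq₃ := quadf_sub_of_contact hA₁ hA₂ hv₃ hg₃ p₁
  have hr₂ := gradf_sub_of_contact hg₂ p₁
  have hr₃ := gradf_sub_of_contact hg₃ p₁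
  rw [hu', mulVec_neg] at hq₂ hr₂
  rw [hv', mulVec_neg] at hq₃ hr₃
  rw [neg_dotProduct_neg] at hq₂ hq₃
  have hM : A₃ = A₁ + (A₃ - A₁) := by abel
  have hN : A₂ = A₁ - (A₁ - A₂) := by abel
  generalize A₃ - A₁ = M at *
  generalize A₁ - A₂ = N at *
  have hgrad : M.mulVec u = -N.mulVec v := by
    rw [← sub_eq_zero, sub_neg_eq_add, ← neg_eq_zero, neg_add, ← hr₂, ← hr₃, hg₁]
    abel
  have hval : u ⬝ᵥ M.mulVec u + v ⬝ᵥ N.mulVec v = 0 := by linarith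
  have swap {S : Matrix (Fin 2) (Fin 2) ℝ} (hS : S.IsSymm) :
      u ⬝ᵥ S.mulVec v = v ⬝ᵥ S.mulVec u := by
    rw [dotProduct_mulVec, ← mulVec_transpose, hS.eq, dotProduct_comm]
  have hMuv : u ⬝ᵥ M.mulVec u = u ⬝ᵥ M.mulVec v := by
    have h : v ⬝ᵥ M.mulVec u = -(v ⬝ᵥ N.mulVec v) := by rw [hgrad, dotProduct_neg]
    rw [swap hsM]
    linarith
  have hNvu : v ⬝ᵥ N.mulVec v = v ⬝ᵥ N.mulVec u := by
    have h : u ⬝ᵥ M.mulVec u = -(u ⬝ᵥ N.mulVec v) := by rw [hgrad, dotProduct_neg]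
    rw [← swap hsN]
    linarith
  have hMe := det_sq_smul_eq_outer_perp hsM hMuv
  have hNe := det_sq_smul_eq_outer_perp hsN hNvu
  rw [show v 0 * u 1 - v 1 * u 0 = -(u 0 * v 1 - u 1 * v 0) by ring, neg_sq,
    outer_perp_sub_comm v u, eq_neg_of_add_eq_zero_right hval] at hNe
  have hd2 := pow_ne_zero 2 hd
  rw [← eq_inv_smul_iff₀ hd2, smul_add, smul_smul, smul_smul] at hMe hNe
  have houter (w : Fin 2 → ℝ) : (outer w).IsSymm := by
    ext i j
    simp [outer, vecMulVec_apply, mul_comm]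
  rw [outer_perp_sub_comm p₁ p₂, ← hu, ← hv, huv]
  generalize ((u 0 * v 1 - u 1 * v 0) ^ 2)⁻¹ = k at *
  refine ⟨A₁ + (k * (u ⬝ᵥ M.mulVec u)) • outer (perp (u - v)), -(k * (u ⬝ᵥ M.mulVec u)),
    -(k * (u ⬝ᵥ N.mulVec u - -(u ⬝ᵥ M.mulVec u))),
    k * (v ⬝ᵥ M.mulVec v - u ⬝ᵥ M.mulVec u), hA₁.add ((houter _).smul _), ?_, ?_, ?_⟩
  · module
  · refine hN.trans ?_
    conv_lhs => rw [hNe]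
    module
  · refine hM.trans ?_
    conv_lhs => rw [hMe]
    module
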